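/- arXiv:2207.00312 — 5 statements merged into one kernel-verified Lean document; each statement's English description precedes it below -/
import Mathlib

section
/- Let (D, σ, α) be a combinatorial map with D nonempty, where α is a fixed-point-free involution, and suppose the subgroup of permutations of D generated by σ and α acts transitively on D (the map is connected). Let V be the number of cycles of σ, E = |D|/2, and F the number of cycles of σ∘α. Then V − E + F ≤ 2 and V − E + F is even; equivalently, the Euler genus (2 − V + E − F)/2 of the map is a nonnegative integer. -/
/-- The number of cycles (orbits) of a permutation `σ` of `D`: the number of
equivalence classes of the "same cycle" relation of `σ` (fixed points count
as 1-cycles). For a combinatorial map `(D, σ, α)`, the vertices are the cycles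
of `σ` and the faces are the cycles of `σ ∘ α`. -/
noncomputable def numCycles {D : Type*} (σ : Equiv.Perm D) : ℕ :=
  Nat.card (Quotient (Setoid.mk σ.SameCycle
    ⟨fun x => Equiv.Perm.SameCycle.refl σ x,
     fun h => h.symm,
     fun h h' => h.trans h'⟩))

open Equiv Equiv.Perm in
theorem numCycles_eq_aux {D : Type*} [Fintype D] [DecidableEq D] (τ : Equiv.Perm D) :
    numCycles τ + τ.support.card = Multiset.card τ.cycleType + Fintype.card D := by
  classical
  have hne : ∀ c : τ.cycleFactorsFinset, ∃ x, x ∈ c.1.support := by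
    intro c
    have := (mem_cycleFactorsFinset_iff.1 c.2).1.nonempty_support
    exact this
  choose e he using hne
  have hcyc : ∀ c : τ.cycleFactorsFinset, τ.cycleOf (e c) = c.1 := fun c =>
    (cycle_is_cycleOf (he c) c.2).symm
  have hsupp : ∀ c : τ.cycleFactorsFinset, e c ∈ τ.support := fun c =>
    mem_cycleFactorsFinset_support_le c.2 (he c)
  let S : Setoid D := Setoid.mk τ.SameCycle
    ⟨fun x => SameCycle.refl τ x, fun h => h.symm, fun h h' => h.trans h'⟩
  let F : τ.cycleFactorsFinset ⊕ {x : D // x ∉ τ.support} → Quotient S :=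
    Sum.elim (fun c => Quotient.mk S (e c)) (fun x => Quotient.mk S x.1)
  have key : ∀ x y : D, x ∉ τ.support → τ.SameCycle x y → x = y := by
    intro x y hx h
    rw [notMem_support] at hx
    obtain ⟨i, rfl⟩ := h
    exact (zpow_apply_eq_self_of_apply_eq_self hx i).symm
  have hF : Function.Bijective F := by
    constructor
    · rintro (c | x) (d | y) h
      · have h' : τ.SameCycle (e c) (e d) := Quotient.exact h
        have := h'.cycleOf_eq
        rw [hcyc, hcyc] at this
        rw [Subtype.ext this]
      · have h' : τ.SameCycle (e c) y.1 := Quotient.exact h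
        have := key _ _ y.2 h'.symm
        exact absurd (this ▸ hsupp c) y.2
      · have h' : τ.SameCycle x.1 (e d) := Quotient.exact h
        have := key _ _ x.2 h'
        exact absurd (this ▸ hsupp d) x.2
      · have h' : τ.SameCycle x.1 y.1 := Quotient.exact h
        rw [Subtype.ext (key _ _ x.2 h')]
    · intro q
      induction q using Quotient.inductionOn with
      | h x =>
        by_cases hx : x ∈ τ.support
        · refine ⟨Sum.inl ⟨τ.cycleOf x, cycleOf_mem_cycleFactorsFinset_iff.2 hx⟩, ?_⟩
          refine Quotient.sound (s := S) ?_
          have := he ⟨τ.cycleOf x, cycleOf_mem_cycleFactorsFinset_iff.2 hx⟩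
          rw [mem_support_cycleOf_iff] at this
          exact this.1.symm
        · exact ⟨Sum.inr ⟨x, hx⟩, rfl⟩
  have h1 : numCycles τ = Nat.card (τ.cycleFactorsFinset ⊕ {x : D // x ∉ τ.support}) :=
    (Nat.card_eq_of_bijective F hF).symm
  have h2 : Multiset.card τ.cycleType = τ.cycleFactorsFinset.card := by
    simp [cycleType_def]
  have h3 : Fintype.card {x : D // x ∉ τ.support} = Fintype.card D - τ.support.card := by
    rw [Fintype.card_subtype_compl, Fintype.card_coe]
  have h4 := τ.support.card_le_univ
  rw [h1, Nat.card_sum, Nat.card_eq_fintype_card, Nat.card_eq_fintype_card, h3, h2,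
    Fintype.card_coe]
  omega

theorem sign_numCycles_aux {D : Type*} [Fintype D] [DecidableEq D] (τ : Equiv.Perm D) :
    Equiv.Perm.sign τ = (-1) ^ (Fintype.card D + numCycles τ) := by
  have h := numCycles_eq_aux τ
  rw [Equiv.Perm.sign_of_cycleType, Equiv.Perm.sum_cycleType]
  have : Even (τ.support.card + Multiset.card τ.cycleType)
      ↔ Even (Fintype.card D + numCycles τ) := by
    grind
  rcases Nat.even_or_odd (τ.support.card + Multiset.card τ.cycleType) with h1 | h1
  · rw [h1.neg_one_pow, (this.1 h1).neg_one_pow]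
  · have h2 : Odd (Fintype.card D + numCycles τ) := by
      rw [← Nat.not_even_iff_odd, ← this, Nat.not_even_iff_odd]; exact h1
    rw [h1.neg_one_pow, h2.neg_one_pow]

theorem two_mul_numCycles_aux {D : Type*} [Fintype D] (α : Equiv.Perm D)
    (hinv : α * α = 1) (hfree : ∀ d : D, α d ≠ d) :
    2 * numCycles α = Fintype.card D := by
  classical
  have h := numCycles_eq_aux α
  have hs : α.support = Finset.univ := by
    ext x; simp [hfree x]
  haveI : Fact (Nat.Prime 2) := ⟨Nat.prime_two⟩
  have hc := Equiv.Perm.cycleType_of_pow_prime_eq_one (p := 2) (σ := α) (by rw [pow_two, hinv])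
  have hsum := α.sum_cycleType
  rw [hc, Multiset.sum_replicate, hs, Finset.card_univ, smul_eq_mul] at hsum
  rw [hs, Finset.card_univ] at h
  omega

/-- functions invariant under `τ` -/
def invFun_aux {D : Type*} (τ : Equiv.Perm D) : Submodule ℚ (D → ℚ) where
  carrier := {f | ∀ x, f (τ x) = f x}
  add_mem' := by intro f g hf hg x; simp [hf x, hg x]
  zero_mem' := by intro x; rfl
  smul_mem' := by intro c f hf x; simp [hf x]

theorem finrank_invFun_aux {D : Type*} [Fintype D] (τ : Equiv.Perm D) :
    Module.finrank ℚ (invFun_aux τ) = numCycles τ := by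
  classical
  let S : Setoid D := Setoid.mk τ.SameCycle
    ⟨fun x => Equiv.Perm.SameCycle.refl τ x, fun h => h.symm, fun h h' => h.trans h'⟩
  have hr : invFun_aux τ = LinearMap.range (LinearMap.funLeft ℚ ℚ (Quotient.mk S)) := by
    apply le_antisymm
    · intro f hf
      have hz : ∀ (i : ℤ) (x : D), f ((τ ^ i) x) = f x := by
        intro i
        induction i using Int.induction_on with
        | zero => simp
        | succ i ih => intro x; rw [zpow_add_one, Equiv.Perm.mul_apply, ih, hf]
        | pred i ih =>
          intro x
          rw [zpow_sub_one, Equiv.Perm.mul_apply, ih, ← hf, ← Equiv.Perm.mul_apply, mul_inv_cancel, Equiv.Perm.one_apply]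
      refine ⟨Quotient.lift f ?_, rfl⟩
      rintro a b ⟨i, rfl⟩
      exact (hz i a).symm
    · rintro _ ⟨g, rfl⟩ x
      simp only [LinearMap.funLeft_apply]
      congr 1
      refine Quotient.sound (s := S) ?_
      exact Equiv.Perm.sameCycle_apply_left.2 (Equiv.Perm.SameCycle.refl τ x)
  rw [hr, LinearMap.finrank_range_of_inj
    (LinearMap.funLeft_injective_of_surjective ℚ ℚ _ Quotient.mk_surjective),
    Module.finrank_fintype_fun_eq_card, ← Nat.card_eq_fintype_card]
  rfl

/-- the antisymmetrisation map -/
def bdry_aux {D : Type*} (α : Equiv.Perm D) : (D → ℚ) →ₗ[ℚ] (D → ℚ) :=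
  LinearMap.id - LinearMap.funLeft ℚ ℚ α

theorem finrank_map_aux {D : Type*} [Fintype D] (τ α : Equiv.Perm D)
    (h : ∀ f : D → ℚ, (∀ x, f (τ x) = f x) → (∀ x, f (α x) = f x) → ∃ c, ∀ x, f x = c) :
    numCycles τ ≤ Module.finrank ℚ ((invFun_aux τ).map (bdry_aux α)) + 1 := by
  have h1 := LinearMap.finrank_range_add_finrank_ker ((bdry_aux α).domRestrict (invFun_aux τ))
  rw [LinearMap.range_domRestrict, finrank_invFun_aux] at h1
  have h2 : Module.finrank ℚ (LinearMap.ker ((bdry_aux α).domRestrict (invFun_aux τ))) ≤ 1 := by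
    refine finrank_le_one ⟨⟨fun _ => 1, fun _ => rfl⟩, ?_⟩ ?_
    · rw [LinearMap.mem_ker]
      ext x
      simp [bdry_aux, LinearMap.funLeft_apply]
    · rintro ⟨⟨f, hf⟩, hk⟩
      rw [LinearMap.mem_ker] at hk
      obtain ⟨c, hc⟩ := h f hf (by
        intro x
        have := congrFun hk x
        simp [bdry_aux, LinearMap.funLeft_apply] at this
        linarith)
      refine ⟨c, ?_⟩
      ext x
      simp [hc x]
  omega

/-- Let `(D, σ, α)` be a connected combinatorial map with `D`
nonempty and finite, where `α` is a fixed-point-free involution and the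
subgroup of permutations generated by `σ` and `α` acts transitively on `D`.
With `V` the number of cycles of `σ`, `E = |D|/2` and `F` the number of cycles
of `σ ∘ α`, we have `V - E + F ≤ 2` and `V - E + F` is even. -/
theorem euler_formula_combinatorial_map {D : Type*} [Fintype D] [Nonempty D]
    (σ α : Equiv.Perm D) (hinv : α * α = 1) (hfree : ∀ d : D, α d ≠ d)
    (hconn : ∀ x y : D, ∃ g ∈ Subgroup.closure ({σ, α} : Set (Equiv.Perm D)), g x = y) :
    (numCycles σ : ℤ) - ((Fintype.card D / 2 : ℕ) : ℤ) + (numCycles (σ * α) : ℤ) ≤ 2 ∧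
      Even ((numCycles σ : ℤ) - ((Fintype.card D / 2 : ℕ) : ℤ) + (numCycles (σ * α) : ℤ)) := by
  classical
  have hE := two_mul_numCycles_aux α hinv hfree
  have hE' : Fintype.card D / 2 = numCycles α := by omega
  have hαα : ∀ x, α (α x) = x := fun x => by
    rw [← Equiv.Perm.mul_apply, hinv, Equiv.Perm.one_apply]
  rw [hE']
  constructor
  · have hconst : ∀ f : D → ℚ, (∀ x, f (σ x) = f x) → (∀ x, f (α x) = f x) →
        ∃ c, ∀ x, f x = c := by
      intro f h1 h2
      have hg : ∀ g ∈ Subgroup.closure ({σ, α} : Set (Equiv.Perm D)), ∀ x, f (g x) = f x := by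
        intro g hg
        induction hg using Subgroup.closure_induction with
        | mem g hg =>
          rcases hg with rfl | rfl
          · exact h1
          · exact h2
        | one => intro x; rfl
        | mul a b _ _ ha hb => intro x; rw [Equiv.Perm.mul_apply, ha, hb]
        | inv a _ ha => intro x; rw [← ha, ← Equiv.Perm.mul_apply, mul_inv_cancel, Equiv.Perm.one_apply]
      obtain ⟨x₀⟩ := ‹Nonempty D›
      refine ⟨f x₀, fun x => ?_⟩
      obtain ⟨g, hgm, rfl⟩ := hconn x₀ x
      exact hg g hgm x₀
    have hV := finrank_map_aux σ α hconst
    have hF := finrank_map_aux (σ * α) α (by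
      intro f h1 h2
      refine hconst f (fun x => ?_) h2
      have := h1 (α x)
      rw [Equiv.Perm.mul_apply, hαα, h2] at this
      exact this)
    have hdisj : (invFun_aux σ).map (bdry_aux α) ⊓ (invFun_aux (σ * α)).map (bdry_aux α) = ⊥ := by
      rw [eq_bot_iff]
      rintro u ⟨⟨f, hf, hfu⟩, ⟨g, hg, hgu⟩⟩
      have hfu' : ∀ x, u x = f x - f (α x) := fun x => by rw [← hfu]; rfl
      have hgu' : ∀ x, u x = g x - g (α x) := fun x => by rw [← hgu]; rfl
      have hg' : ∀ x, g (σ x) = g (α x) := fun x => by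
        have := hg (α x)
        rwa [Equiv.Perm.mul_apply, hαα] at this
      have e1 : ∑ x, f x * g (α x) = ∑ x, f x * g x := by
        rw [← Equiv.sum_comp σ (fun x => f x * g x)]
        exact Finset.sum_congr rfl fun x _ => by rw [hg', hf x]
      have e2 : ∑ x, f (α x) * g x = ∑ x, f x * g (α x) := by
        rw [← Equiv.sum_comp α (fun x => f x * g (α x))]
        exact Finset.sum_congr rfl fun x _ => by rw [hαα]
      have e3 : ∑ x, f (α x) * g (α x) = ∑ x, f x * g x :=
        Equiv.sum_comp α (fun x => f x * g x)
      have e4 : ∑ x, u x * u x = 0 := by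
        have : ∀ x, u x * u x =
            f x * g x - f x * g (α x) - f (α x) * g x + f (α x) * g (α x) := fun x => by
          nth_rewrite 1 [hfu']
          rw [hgu']; ring
        simp only [this, Finset.sum_add_distrib, Finset.sum_sub_distrib]
        rw [e3, e2, e1]; ring
      rw [Finset.sum_eq_zero_iff_of_nonneg (fun x _ => mul_self_nonneg _)] at e4
      rw [Submodule.mem_bot]
      ext x
      simpa using e4 x (Finset.mem_univ x)
    have hsup : (invFun_aux σ).map (bdry_aux α) ⊔ (invFun_aux (σ * α)).map (bdry_aux α)
        ≤ LinearMap.range (bdry_aux α) :=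
      sup_le LinearMap.map_le_range LinearMap.map_le_range
    have d1 := Submodule.finrank_sup_add_finrank_inf_eq
      ((invFun_aux σ).map (bdry_aux α)) ((invFun_aux (σ * α)).map (bdry_aux α))
    rw [hdisj, finrank_bot] at d1
    have d2 := Submodule.finrank_mono hsup
    have d3 := LinearMap.finrank_range_add_finrank_ker (bdry_aux α)
    rw [Module.finrank_fintype_fun_eq_card] at d3
    have hker : invFun_aux α ≤ LinearMap.ker (bdry_aux α) := by
      intro f hf
      rw [LinearMap.mem_ker]
      ext x
      have := hf x
      simp [bdry_aux, LinearMap.funLeft_apply, this]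
    have d4 := Submodule.finrank_mono hker
    rw [finrank_invFun_aux] at d4
    omega
  · have hs := Equiv.Perm.sign_mul σ α
    rw [sign_numCycles_aux, sign_numCycles_aux, sign_numCycles_aux, ← pow_add] at hs
    have hpar : Even (Fintype.card D + numCycles (σ * α)) ↔
        Even (Fintype.card D + numCycles σ + (Fintype.card D + numCycles α)) := by
      rw [← neg_one_pow_eq_one_iff_even (R := ℤˣ) (by decide), hs,
        neg_one_pow_eq_one_iff_even (by decide)]
    rw [← hE] at hpar
    simp only [Nat.even_iff] at hpar
    rw [Int.even_iff]
    omega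
end

section
/- For every even integer n ≥ 2, the composite permutation σ∘α of the fan map F_n is a single cycle on all 2(3n−2) darts; that is, F_n has exactly one face. Consequently, since F_n has 2n+1 vertices and 3n−2 edges, its Euler genus (2 − V + E − F)/2 equals (n−2)/2. -/
/-- The edges of the fan map `F_n`, where `n = m + 2`:
* `Sum.inl j` (for `j : Fin (m+2)`) is the edge `e_{j+2}`; so `e_2, …, e_{n+1}`,
  where `e_2 = b c_2`, `e_j = c_{j-1} c_j` for `3 ≤ j ≤ n`, and `e_{n+1} = c_n v_1`;
* `Sum.inr (Sum.inl k)` (for `k : Fin (m+1)`) is the edge `f_{k+2} = r c_{k+2}`;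
* `Sum.inr (Sum.inr k)` (for `k : Fin (m+1)`) is the edge `g_{k+2} = c_{k+2} v_{k+2}`. -/
abbrev FanEdge (m : ℕ) := Fin (m + 2) ⊕ Fin (m + 1) ⊕ Fin (m + 1)

/-- The darts of the fan map `F_n` (`n = m + 2`): each edge carries two darts,
one at each endpoint. For the edges `e_{j+2}` (`Sum.inl j`), the dart labelled
`false` is at the endpoint closer to `b` (namely `b` for `e_2` and `c_{j+1}`
for `j ≥ 1`), and the dart labelled `true` is at the other endpoint (`c_{j+2}`,
or `v_1` for the last edge `e_{n+1}`). For the edges `f_{k+2} = r c_{k+2}` the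
dart `false` is at `r` and `true` is at `c_{k+2}`; for `g_{k+2} = c_{k+2} v_{k+2}`
the dart `false` is at `c_{k+2}` and `true` is at `v_{k+2}`. -/
abbrev FanDart (m : ℕ) := FanEdge m × Bool

/-- The edge involution `α` of the fan map: it exchanges the two darts of each edge. -/
def dartFlip {E : Type*} : Equiv.Perm (E × Bool) :=
  Equiv.prodCongr (Equiv.refl E) ⟨not, not, Bool.not_not, Bool.not_not⟩

theorem numCycles_eq_card {D V : Type*} (σ : Equiv.Perm D) (vtx : D → V) (rep : V → D)
    (h1 : ∀ x, vtx (σ x) = vtx x) (h2 : ∀ v, vtx (rep v) = v)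
    (h3 : ∀ x, σ.SameCycle (rep (vtx x)) x) : numCycles σ = Nat.card V := by
  have hinv : ∀ x y, σ.SameCycle x y → vtx x = vtx y := by
    have hp : ∀ (k : ℕ) x, vtx ((σ ^ k) x) = vtx x := by
      intro k
      induction k with
      | zero => intro x; simp
      | succ k ih => intro x; rw [pow_succ', Equiv.Perm.mul_apply, h1, ih]
    rintro x y ⟨i, rfl⟩
    obtain ⟨k, rfl | rfl⟩ := i.eq_nat_or_neg
    · simp [hp]
    · have := hp k ((σ ^ (-(k : ℤ))) x)
      rw [← this, ← zpow_natCast, ← Equiv.Perm.mul_apply, ← zpow_add]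
      simp
  unfold numCycles
  refine Nat.card_congr ⟨fun q => Quotient.lift vtx (fun a b h => hinv a b h) q,
    fun v => Quotient.mk _ (rep v), ?_, ?_⟩
  · intro q
    induction q using Quotient.inductionOn with
    | h x => exact Quotient.sound (h3 x)
  · intro v
    exact h2 v

/-- The vertex at which a dart of the fan map sits: `inl 0`, `inl 1`, `inl 2` are `b`, `v_1`, `r`,
`inr (inl k)` is `c_{k+2}` and `inr (inr k)` is `v_{k+2}`. -/
def fanVtx (m : ℕ) : FanDart m → Fin 3 ⊕ Fin (m + 1) ⊕ Fin (m + 1)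
  | (Sum.inl j, false) => Fin.cases (Sum.inl 0) (fun k => Sum.inr (Sum.inl k)) j
  | (Sum.inl j, true) => Fin.lastCases (Sum.inl 1) (fun k => Sum.inr (Sum.inl k)) j
  | (Sum.inr (Sum.inl _), false) => Sum.inl 2
  | (Sum.inr (Sum.inl k), true) => Sum.inr (Sum.inl k)
  | (Sum.inr (Sum.inr k), false) => Sum.inr (Sum.inl k)
  | (Sum.inr (Sum.inr k), true) => Sum.inr (Sum.inr k)

/-- A dart at each vertex of the fan map. -/
def fanRep (m : ℕ) : Fin 3 ⊕ Fin (m + 1) ⊕ Fin (m + 1) → FanDart m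
  | Sum.inl 0 => (Sum.inl 0, false)
  | Sum.inl 1 => (Sum.inl (Fin.last (m + 1)), true)
  | Sum.inl 2 => (Sum.inr (Sum.inl 0), false)
  | Sum.inr (Sum.inl k) => (Sum.inl k.castSucc, true)
  | Sum.inr (Sum.inr k) => (Sum.inr (Sum.inr k), true)

/-- For every even `n ≥ 2` (written `n = m + 2`), the composite
permutation `σ ∘ α` of the fan map `F_n` is a single cycle on all `2(3n-2)`
darts, i.e. `F_n` has exactly one face; consequently (as `F_n` has `2n+1`
vertices and `3n-2` edges) its Euler genus `(2 - V + E - F)/2` equals `(n-2)/2`.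

Here `σ` is the rotation of `F_n`, specified by the hypotheses: it fixes the
unique dart at each of `b, v_1, …, v_n`; at `r` it is the cycle
`(r,f_2) → (r,f_3) → ⋯ → (r,f_n) → (r,f_2)`; and at each `c_j` (`2 ≤ j ≤ n`,
`j = k + 2`) it is the 4-cycle
`(c_j,e_j) → (c_j,f_j) → (c_j,e_{j+1}) → (c_j,g_j) → (c_j,e_j)`. -/
theorem fan_map_even_one_face (m n : ℕ) (hn : n = m + 2) (hev : Even n)
    (σ : Equiv.Perm (FanDart m))
    -- σ fixes the unique dart at b (the dart of e_2 at b)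
    (hb : σ (Sum.inl 0, false) = (Sum.inl 0, false))
    -- σ fixes the unique dart at v_1 (the dart of e_{n+1} at v_1)
    (hv1 : σ (Sum.inl (Fin.last (m + 1)), true) = (Sum.inl (Fin.last (m + 1)), true))
    -- σ fixes the unique dart at each v_{k+2} (the dart of g_{k+2} at v_{k+2})
    (hv : ∀ k : Fin (m + 1), σ (Sum.inr (Sum.inr k), true) = (Sum.inr (Sum.inr k), true))
    -- at r: (r,f_j) ↦ (r,f_{j+1}), cyclically
    (hr : ∀ k : Fin (m + 1),
      σ (Sum.inr (Sum.inl k), false) = (Sum.inr (Sum.inl (k + 1)), false))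
    -- at c_j (j = k+2): (c_j,e_j) ↦ (c_j,f_j)
    (hc1 : ∀ k : Fin (m + 1), σ (Sum.inl k.castSucc, true) = (Sum.inr (Sum.inl k), true))
    -- at c_j: (c_j,f_j) ↦ (c_j,e_{j+1})
    (hc2 : ∀ k : Fin (m + 1), σ (Sum.inr (Sum.inl k), true) = (Sum.inl k.succ, false))
    -- at c_j: (c_j,e_{j+1}) ↦ (c_j,g_j)
    (hc3 : ∀ k : Fin (m + 1), σ (Sum.inl k.succ, false) = (Sum.inr (Sum.inr k), false))
    -- at c_j: (c_j,g_j) ↦ (c_j,e_j)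
    (hc4 : ∀ k : Fin (m + 1), σ (Sum.inr (Sum.inr k), false) = (Sum.inl k.castSucc, true)) :
    (∀ x y : FanDart m, (σ * dartFlip).SameCycle x y) ∧
      numCycles (σ * dartFlip) = 1 ∧
      (2 - (numCycles σ : ℤ) + (3 * (n : ℤ) - 2) - (numCycles (σ * dartFlip) : ℤ)) / 2
        = ((n : ℤ) - 2) / 2 := by
  have hstep : ∀ (τ : Equiv.Perm (FanDart m)) {a x y : FanDart m}, τ x = y →
      (τ.SameCycle a y ↔ τ.SameCycle a x) := by
    rintro τ a x y rfl
    exact Equiv.Perm.sameCycle_apply_right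
  -- the number of vertices
  have hV : numCycles σ = 2 * m + 5 := by
    rw [numCycles_eq_card σ (fanVtx m) (fanRep m)]
    · simp; ring
    · rintro ⟨j | k | k, _ | _⟩
      · refine Fin.cases ?_ (fun k => ?_) j
        · rw [hb]
        · rw [hc3]; simp [fanVtx]
      · refine Fin.lastCases ?_ (fun k => ?_) j
        · rw [hv1]
        · rw [hc1]; simp [fanVtx]
      · rw [hr]; simp [fanVtx]
      · rw [hc2]; simp [fanVtx]
      · rw [hc4]; simp [fanVtx]
      · rw [hv]
    · rintro (i | k | k)
      · fin_cases i <;> simp [fanVtx, fanRep]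
      · simp [fanVtx, fanRep]
      · simp [fanVtx, fanRep]
    · have q1 : ∀ k : Fin (m + 1),
          σ.SameCycle (Sum.inl k.castSucc, true) (Sum.inr (Sum.inl k), true) := fun k =>
        (hstep σ (hc1 k)).2 (Equiv.Perm.SameCycle.refl _ _)
      have q2 : ∀ k : Fin (m + 1),
          σ.SameCycle (Sum.inl k.castSucc, true) (Sum.inl k.succ, false) := fun k =>
        (hstep σ (hc2 k)).2 (q1 k)
      have q3 : ∀ k : Fin (m + 1),
          σ.SameCycle (Sum.inl k.castSucc, true) (Sum.inr (Sum.inr k), false) := fun k =>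
        (hstep σ (hc3 k)).2 (q2 k)
      have q4 : ∀ k : Fin (m + 1),
          σ.SameCycle (Sum.inr (Sum.inl 0), false) (Sum.inr (Sum.inl k), false) := by
        intro k
        induction k using Fin.induction with
        | zero => exact Equiv.Perm.SameCycle.refl _ _
        | succ k ih =>
          have := hr k.castSucc
          rw [Fin.coeSucc_eq_succ] at this
          exact (hstep σ this).2 ih
      rintro ⟨j | k | k, _ | _⟩
      · refine Fin.cases ?_ (fun k => ?_) j
        · simp [fanVtx, fanRep, Equiv.Perm.SameCycle.refl]
        · simpa [fanVtx, fanRep] using q2 k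
      · refine Fin.lastCases ?_ (fun k => ?_) j
        · simp [fanVtx, fanRep, Equiv.Perm.SameCycle.refl]
        · simp [fanVtx, fanRep, Equiv.Perm.SameCycle.refl]
      · simpa [fanVtx, fanRep] using q4 k
      · simpa [fanVtx, fanRep] using q1 k
      · simpa [fanVtx, fanRep] using q3 k
      · simp [fanVtx, fanRep, Equiv.Perm.SameCycle.refl]
  -- the face permutation
  have p1 : ∀ k : Fin (m + 1),
      (σ * dartFlip : Equiv.Perm (FanDart m)) (Sum.inl k.castSucc, false) = (Sum.inr (Sum.inl k), true) := hc1
  have p2 : (σ * dartFlip : Equiv.Perm (FanDart m)) (Sum.inl (Fin.last (m + 1)), false)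
      = (Sum.inl (Fin.last (m + 1)), true) := hv1
  have p4 : ∀ k : Fin (m + 1),
      (σ * dartFlip : Equiv.Perm (FanDart m)) (Sum.inl k.succ, true) = (Sum.inr (Sum.inr k), false) := hc3
  have p5 : ∀ k : Fin (m + 1),
      (σ * dartFlip : Equiv.Perm (FanDart m)) (Sum.inr (Sum.inl k), false) = (Sum.inl k.succ, false) := hc2
  have p6 : ∀ k : Fin (m + 1),
      (σ * dartFlip : Equiv.Perm (FanDart m)) (Sum.inr (Sum.inl k), true) = (Sum.inr (Sum.inl (k + 1)), false) := hr
  have p7 : ∀ k : Fin (m + 1),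
      (σ * dartFlip : Equiv.Perm (FanDart m)) (Sum.inr (Sum.inr k), false) = (Sum.inr (Sum.inr k), true) := hv
  have p8 : ∀ k : Fin (m + 1),
      (σ * dartFlip : Equiv.Perm (FanDart m)) (Sum.inr (Sum.inr k), true) = (Sum.inl k.castSucc, true) := hc4
  have hm : Even m := by
    subst hn
    simpa [Nat.even_add] using hev
  generalize hφ : σ * dartFlip = φ at *
  have key : ∀ k : Fin (m + 1), φ.SameCycle (Sum.inl 0, false) (Sum.inl k.castSucc, false) →
      φ.SameCycle (Sum.inl 0, false) (Sum.inl (k + 1).succ, false) := fun k h =>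
    (hstep φ (p5 _)).2 ((hstep φ (p6 k)).2 ((hstep φ (p1 k)).2 h))
  have step2 : ∀ j (h : j + 2 < m + 2),
      φ.SameCycle (Sum.inl 0, false) (Sum.inl ⟨j, by omega⟩, false) →
      φ.SameCycle (Sum.inl 0, false) (Sum.inl ⟨j + 2, h⟩, false) := by
    intro j h hj
    have := key ⟨j, by omega⟩ hj
    convert this using 4
    rw [Fin.val_succ, Fin.val_add_one_of_lt]
    rw [Fin.lt_def]; simp; omega
  have hevens : ∀ i (h : 2 * i < m + 2),
      φ.SameCycle (Sum.inl 0, false) (Sum.inl ⟨2 * i, h⟩, false) := by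
    intro i
    induction i with
    | zero => intro h; exact Equiv.Perm.SameCycle.refl _ _
    | succ i ih => intro h; exact step2 (2 * i) h (ih (by omega))
  have hodd : ∀ i (h : 2 * i + 1 < m + 2),
      φ.SameCycle (Sum.inl 0, false) (Sum.inl ⟨2 * i + 1, h⟩, false) := by
    intro i
    induction i with
    | zero =>
      intro h
      obtain ⟨l, hl⟩ := hm
      have h0 := hevens l (by omega)
      have := key (Fin.last m) (by
        convert h0 using 4
        simp; omega)
      rw [Fin.last_add_one] at this
      exact this
    | succ i ih => intro h; exact step2 (2 * i + 1) h (ih (by omega))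
  have hF : ∀ j : Fin (m + 2), φ.SameCycle (Sum.inl 0, false) (Sum.inl j, false) := by
    rintro ⟨j, h⟩
    obtain ⟨i, rfl | rfl⟩ := Nat.even_or_odd' j
    · exact hevens i h
    · exact hodd i h
  have hT : ∀ j : Fin (m + 2), φ.SameCycle (Sum.inl 0, false) (Sum.inl j, true) := by
    intro j
    induction j using Fin.reverseInduction with
    | last => exact (hstep φ p2).2 (hF _)
    | cast k ih => exact (hstep φ (p8 k)).2 ((hstep φ (p7 k)).2 ((hstep φ (p4 k)).2 ih))
  have hall : ∀ x, φ.SameCycle (Sum.inl 0, false) x := by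
    rintro ⟨j | k | k, _ | _⟩
    · exact hF j
    · exact hT j
    · exact (hstep φ (p5 k)).1 (hF _)
    · exact (hstep φ (p1 k)).2 (hF _)
    · exact (hstep φ (p4 k)).2 (hT _)
    · exact (hstep φ (p8 k)).1 (hT _)
  have hone : numCycles φ = 1 := by
    rw [numCycles_eq_card φ (fun _ => ()) (fun _ => (Sum.inl 0, false)) (fun _ => rfl)
      (fun _ => rfl) hall]
    simp
  refine ⟨fun x y => (hall x).symm.trans (hall y), hone, ?_⟩
  rw [hone, hV, hn]
  congr 1
  push_cast
  ring
end

section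
/- For every odd integer n ≥ 3, the fan map F_n has exactly two faces; that is, the permutation σ∘α has exactly two cycles on the 2(3n−2) darts of F_n. -/
/-- The face colour of a dart: `false` for the face through `b`, `true` for the other. -/
def fanColour (m : ℕ) : FanDart m → Bool
  | (Sum.inl _, true) => false
  | (Sum.inl i, false) => decide (i.val % 2 = 1)
  | (Sum.inr (Sum.inl k), true) => decide (k.val % 2 = 1)
  | (Sum.inr (Sum.inl k), false) => decide (k.val % 2 = 0)
  | (Sum.inr (Sum.inr _), _) => false

/-- For every odd `n ≥ 3` (written `n = m + 2` with `n` odd), the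
fan map `F_n` has exactly two faces: the permutation `σ ∘ α` has exactly two
cycles on the `2(3n-2)` darts of `F_n`.

Here `σ` is the rotation of `F_n`, specified by the hypotheses: it fixes the
unique dart at each of `b, v_1, …, v_n`; at `r` it is the cycle
`(r,f_2) → (r,f_3) → ⋯ → (r,f_n) → (r,f_2)`; and at each `c_j` (`2 ≤ j ≤ n`,
`j = k + 2`) it is the 4-cycle
`(c_j,e_j) → (c_j,f_j) → (c_j,e_{j+1}) → (c_j,g_j) → (c_j,e_j)`. -/
theorem fan_map_odd_two_faces (m n : ℕ) (hn : n = m + 2) (hodd : Odd n)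
    (σ : Equiv.Perm (FanDart m))
    -- σ fixes the unique dart at b (the dart of e_2 at b)
    (hb : σ (Sum.inl 0, false) = (Sum.inl 0, false))
    -- σ fixes the unique dart at v_1 (the dart of e_{n+1} at v_1)
    (hv1 : σ (Sum.inl (Fin.last (m + 1)), true) = (Sum.inl (Fin.last (m + 1)), true))
    -- σ fixes the unique dart at each v_{k+2} (the dart of g_{k+2} at v_{k+2})
    (hv : ∀ k : Fin (m + 1), σ (Sum.inr (Sum.inr k), true) = (Sum.inr (Sum.inr k), true))
    -- at r: (r,f_j) ↦ (r,f_{j+1}), cyclically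
    (hr : ∀ k : Fin (m + 1),
      σ (Sum.inr (Sum.inl k), false) = (Sum.inr (Sum.inl (k + 1)), false))
    -- at c_j (j = k+2): (c_j,e_j) ↦ (c_j,f_j)
    (hc1 : ∀ k : Fin (m + 1), σ (Sum.inl k.castSucc, true) = (Sum.inr (Sum.inl k), true))
    -- at c_j: (c_j,f_j) ↦ (c_j,e_{j+1})
    (hc2 : ∀ k : Fin (m + 1), σ (Sum.inr (Sum.inl k), true) = (Sum.inl k.succ, false))
    -- at c_j: (c_j,e_{j+1}) ↦ (c_j,g_j)
    (hc3 : ∀ k : Fin (m + 1), σ (Sum.inl k.succ, false) = (Sum.inr (Sum.inr k), false))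
    -- at c_j: (c_j,g_j) ↦ (c_j,e_j)
    (hc4 : ∀ k : Fin (m + 1), σ (Sum.inr (Sum.inr k), false) = (Sum.inl k.castSucc, true)) :
    numCycles (σ * dartFlip) = 2 := by
  have hm : m % 2 = 1 := by
    obtain ⟨t, ht⟩ := hodd
    omega
  set φ := σ * dartFlip with hφ
  have hf : ∀ (e : FanEdge m) (b : Bool), φ (e, b) = σ (e, !b) := fun e b => rfl
  have add1 : ∀ k : Fin (m + 1), (k + 1).val = if k.val = m then 0 else k.val + 1 := by
    intro k
    rw [Fin.val_add_one]
    simp [Fin.ext_iff]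
  have hinv : ∀ x, fanColour m (φ x) = fanColour m x := by
    rintro ⟨e | k | k, b⟩
    · cases b
      · rw [hf]
        induction e using Fin.lastCases with
        | last =>
          simp only [Bool.not_false, hv1, fanColour, Fin.val_last]
          simp; omega
        | cast k => simp [hc1, fanColour]
      · rw [hf]
        induction e using Fin.cases with
        | zero => simp [hb, fanColour]
        | succ k => simp [hc3, fanColour]
    · cases b
      · rw [hf]
        simp only [Bool.not_false, hc2, fanColour, Fin.val_succ, decide_eq_decide]
        omega
      · rw [hf]
        simp only [Bool.not_true, hr, fanColour, add1, decide_eq_decide]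
        split_ifs <;> omega
    · cases b
      · rw [hf]; simp [hv, fanColour]
      · rw [hf]; simp [hc4, fanColour]
  have hinvS : ∀ x y, φ.SameCycle x y → fanColour m x = fanColour m y := by
    intro x y h
    obtain ⟨i, -, rfl⟩ := h.exists_pow_eq'
    clear h
    induction i with
    | zero => rfl
    | succ i ih => rw [pow_succ', Equiv.Perm.mul_apply, hinv]; exact ih
  have step : ∀ x y, φ x = y → φ.SameCycle x y := by
    rintro x y rfl
    exact ⟨1, by simp⟩
  -- the chain `E_i true → ⋯ → E_0 true → E_0 false`
  have hA : ∀ i : Fin (m + 2), φ.SameCycle (Sum.inl i, true) (Sum.inl 0, false) := by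
    intro i
    induction i using Fin.induction with
    | zero => exact step _ _ (by rw [hf]; exact hb)
    | succ k ih =>
      exact ((step _ (Sum.inr (Sum.inr k), false) (by rw [hf]; exact hc3 k)).trans
        (step _ (Sum.inr (Sum.inr k), true) (by rw [hf]; exact hv k))).trans
        ((step _ _ (by rw [hf]; exact hc4 k)).trans ih)
  have hB : ∀ (i : ℕ) (h : i < m + 2), φ.SameCycle (Sum.inl ⟨i, h⟩, false)
      (Sum.inl ⟨i % 2, by omega⟩, false) := by
    intro i
    induction i using Nat.strong_induction_on with
    | _ i ih =>
      intro h
      by_cases hi : i < 2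
      · have : i % 2 = i := Nat.mod_eq_of_lt hi
        simp only [this]
        exact Equiv.Perm.SameCycle.refl _ _
      · obtain ⟨j, rfl⟩ : ∃ j, i = j + 2 := ⟨i - 2, by omega⟩
        have h1 := ih j (by omega) (by omega)
        simp only [Nat.add_mod_right]
        refine Equiv.Perm.SameCycle.trans (Equiv.Perm.SameCycle.symm ?_) h1
        have e1 : (⟨j, by omega⟩ : Fin (m + 1)) + 1 = ⟨j + 1, by omega⟩ := by
          apply Fin.ext
          rw [add1]
          simp only
          rw [if_neg (by omega)]
        exact ((step _ (Sum.inr (Sum.inl ⟨j, by omega⟩), true)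
            (by rw [hf]; exact hc1 ⟨j, by omega⟩)).trans
          (step _ (Sum.inr (Sum.inl ⟨j + 1, by omega⟩), false)
            (by rw [hf, ← e1]; exact hr ⟨j, by omega⟩))).trans
          (step _ _ (by rw [hf]; exact hc2 ⟨j + 1, by omega⟩))
  let rep : Bool → FanDart m := fun b => (Sum.inl (if b then 1 else 0), false)
  have hback : ∀ x, φ.SameCycle (φ x) (rep (fanColour m (φ x))) →
      φ.SameCycle x (rep (fanColour m x)) := by
    intro x h
    rw [hinv] at h
    exact (step x _ rfl).trans h
  have hEt : ∀ i, φ.SameCycle (Sum.inl i, true) (rep (fanColour m (Sum.inl i, true))) := hA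
  have hEf : ∀ i, φ.SameCycle (Sum.inl i, false) (rep (fanColour m (Sum.inl i, false))) := by
    intro i
    convert hB i.val i.isLt using 3
    rcases Nat.mod_two_eq_zero_or_one i.val with h | h <;>
      simp [fanColour, h, Fin.ext_iff]
  have hFf : ∀ k, φ.SameCycle (Sum.inr (Sum.inl k), false)
      (rep (fanColour m (Sum.inr (Sum.inl k), false))) := by
    intro k
    apply hback
    rw [hf, Bool.not_false, hc2]
    exact hEf _
  have hGt : ∀ k, φ.SameCycle (Sum.inr (Sum.inr k), true)
      (rep (fanColour m (Sum.inr (Sum.inr k), true))) := by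
    intro k
    apply hback
    rw [hf, Bool.not_true, hc4]
    exact hEt _
  have hrep : ∀ x, φ.SameCycle x (rep (fanColour m x)) := by
    rintro ⟨e | k | k, _ | _⟩
    · exact hEf e
    · exact hEt e
    · exact hFf k
    · apply hback
      rw [hf, Bool.not_true, hr]
      exact hFf _
    · apply hback
      rw [hf, Bool.not_false, hv]
      exact hGt _
    · exact hGt k
  have hcr : ∀ b, fanColour m (rep b) = b := by
    intro b
    cases b <;> simp [rep, fanColour]
  unfold numCycles
  rw [← Nat.card_congr (Equiv.refl Bool) |>.trans (Nat.card_eq_fintype_card.trans Fintype.card_bool)]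
  apply Nat.card_eq_of_bijective (Quotient.lift (fanColour m) hinvS)
  constructor
  · rintro ⟨x⟩ ⟨y⟩ hxy
    apply Quotient.sound
    change fanColour m x = fanColour m y at hxy
    have h1 := hrep x
    rw [hxy] at h1
    exact h1.trans (hrep y).symm
  · intro b
    exact ⟨Quotient.mk _ (rep b), hcr b⟩
end

section
/- For every even integer n ≥ 2, the composite permutation σ∘α of the dual fan map G_n is a single cycle on all 2(3n−2) darts; that is, G_n has exactly one face. Consequently, since G_n has 2n+1 vertices and 3n−2 edges, its Euler genus (2 − V + E − F)/2 equals (n−2)/2. -/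
/-- The edges of the dual fan map `G_n`, where `n = m + 2`:
* `Sum.inl j` (for `j : Fin (m+2)`) is the edge `R_{j+1}`; so `R_1, …, R_n`,
  where `R_1 = r y_2`, `R_j = y_j y_{j+1}` for `2 ≤ j ≤ n-1`, and `R_n = y_n v_1`;
* `Sum.inr (Sum.inl k)` (for `k : Fin (m+1)`) is the edge `B_{k+2} = b y_{k+2}`;
* `Sum.inr (Sum.inr k)` (for `k : Fin (m+1)`) is the edge `C_{k+2} = y_{k+2} v_{k+2}`. -/
abbrev DualFanEdge (m : ℕ) := Fin (m + 2) ⊕ Fin (m + 1) ⊕ Fin (m + 1)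

/-- The darts of the dual fan map `G_n` (`n = m + 2`): each edge carries two
darts, one at each endpoint. For the edges `R_{j+1}` (`Sum.inl j`), the dart
labelled `false` is at the endpoint closer to `r` (namely `r` for `R_1` and
`y_{j+1}` for `j ≥ 1`), and the dart labelled `true` is at the other endpoint
(`y_{j+2}`, or `v_1` for the last edge `R_n`). For the edges `B_{k+2} = b y_{k+2}`
the dart `false` is at `b` and `true` is at `y_{k+2}`; for
`C_{k+2} = y_{k+2} v_{k+2}` the dart `false` is at `y_{k+2}` and `true` is at
`v_{k+2}`. -/
abbrev DualFanDart (m : ℕ) := DualFanEdge m × Bool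

theorem sameCycle_inv_fun {D T : Type*} (σ : Equiv.Perm D) (f : D → T)
    (hf : ∀ x, f (σ x) = f x) {x y : D} (h : σ.SameCycle x y) : f x = f y := by
  obtain ⟨i, rfl⟩ := h
  induction i with
  | zero => simp
  | succ i ih => rw [add_comm, zpow_add, zpow_one, Equiv.Perm.mul_apply, hf]; exact ih
  | pred i ih =>
    rw [ih, ← hf ((σ ^ (-(i : ℤ) - 1)) x), ← Equiv.Perm.mul_apply, ← zpow_one_add]
    congr 3
    ring

theorem numCycles_eq_card_s4 {D T : Type*} (σ : Equiv.Perm D) (f : D → T) (s : T → D)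
    (hf : ∀ x, f (σ x) = f x) (hfs : ∀ t, f (s t) = t)
    (hs : ∀ x, σ.SameCycle (s (f x)) x) : numCycles σ = Nat.card T := by
  unfold numCycles
  refine Nat.card_congr ⟨Quotient.lift f fun a b h => sameCycle_inv_fun σ f hf h,
    fun t => Quotient.mk _ (s t), ?_, ?_⟩
  · intro q
    induction q using Quotient.inductionOn with
    | _ x => exact Quotient.sound (hs x)
  · intro t
    exact hfs t

theorem numCycles_eq_one {D : Type*} (σ : Equiv.Perm D) (x : D)
    (h : ∀ x y, σ.SameCycle x y) : numCycles σ = 1 := by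
  rw [numCycles_eq_card_s4 σ (fun _ => ()) (fun _ => x) (fun _ => rfl) (fun _ => rfl)
    (fun y => h _ _)]
  simp

/-- The vertex at which a dart sits: `inl 0, inl 1, inl 2` are `r`, `v_1`, `b`,
then the `v_{k+2}`, then the `y_{k+2}`. -/
def dualFanVertex (m : ℕ) : DualFanDart m → Fin 3 ⊕ Fin (m + 1) ⊕ Fin (m + 1)
  | (Sum.inl j, false) => Fin.cases (Sum.inl 0) (fun k => Sum.inr (Sum.inr k)) j
  | (Sum.inl j, true) => Fin.lastCases (Sum.inl 1) (fun k => Sum.inr (Sum.inr k)) j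
  | (Sum.inr (Sum.inl _), false) => Sum.inl 2
  | (Sum.inr (Sum.inl k), true) => Sum.inr (Sum.inr k)
  | (Sum.inr (Sum.inr k), false) => Sum.inr (Sum.inr k)
  | (Sum.inr (Sum.inr k), true) => Sum.inr (Sum.inl k)

/-- A dart at each vertex. -/
def dualFanSection (m : ℕ) : Fin 3 ⊕ Fin (m + 1) ⊕ Fin (m + 1) → DualFanDart m
  | Sum.inl 0 => (Sum.inl 0, false)
  | Sum.inl 1 => (Sum.inl (Fin.last (m + 1)), true)
  | Sum.inl 2 => (Sum.inr (Sum.inl 0), false)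
  | Sum.inr (Sum.inl k) => (Sum.inr (Sum.inr k), true)
  | Sum.inr (Sum.inr k) => (Sum.inr (Sum.inl k), true)

/-- For every even `n ≥ 2` (written `n = m + 2`), the composite
permutation `σ ∘ α` of the dual fan map `G_n` is a single cycle on all
`2(3n-2)` darts, i.e. `G_n` has exactly one face; consequently (as `G_n` has
`2n+1` vertices and `3n-2` edges) its Euler genus `(2 - V + E - F)/2` equals
`(n-2)/2`.

Here `σ` is the rotation of `G_n`, specified by the hypotheses: it fixes the
unique dart at each of `r, v_1, …, v_n`; at `b` it is the cycle
`(b,B_n) → (b,B_{n-1}) → ⋯ → (b,B_2) → (b,B_n)`; and at each `y_j`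
(`2 ≤ j ≤ n`, `j = k + 2`) it is the 4-cycle
`(y_j,B_j) → (y_j,R_{j-1}) → (y_j,C_j) → (y_j,R_j) → (y_j,B_j)`. -/
theorem dual_fan_map_even_one_face (m n : ℕ) (hn : n = m + 2) (hev : Even n)
    (σ : Equiv.Perm (DualFanDart m))
    -- σ fixes the unique dart at r (the dart of R_1 at r)
    (hr : σ (Sum.inl 0, false) = (Sum.inl 0, false))
    -- σ fixes the unique dart at v_1 (the dart of R_n at v_1)
    (hv1 : σ (Sum.inl (Fin.last (m + 1)), true) = (Sum.inl (Fin.last (m + 1)), true))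
    -- σ fixes the unique dart at each v_{k+2} (the dart of C_{k+2} at v_{k+2})
    (hv : ∀ k : Fin (m + 1), σ (Sum.inr (Sum.inr k), true) = (Sum.inr (Sum.inr k), true))
    -- at b: (b,B_j) ↦ (b,B_{j-1}), cyclically (so (b,B_2) ↦ (b,B_n))
    (hb : ∀ k : Fin (m + 1),
      σ (Sum.inr (Sum.inl k), false) = (Sum.inr (Sum.inl (k - 1)), false))
    -- at y_j (j = k+2): (y_j,B_j) ↦ (y_j,R_{j-1})
    (hy1 : ∀ k : Fin (m + 1), σ (Sum.inr (Sum.inl k), true) = (Sum.inl k.castSucc, true))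
    -- at y_j: (y_j,R_{j-1}) ↦ (y_j,C_j)
    (hy2 : ∀ k : Fin (m + 1), σ (Sum.inl k.castSucc, true) = (Sum.inr (Sum.inr k), false))
    -- at y_j: (y_j,C_j) ↦ (y_j,R_j)
    (hy3 : ∀ k : Fin (m + 1), σ (Sum.inr (Sum.inr k), false) = (Sum.inl k.succ, false))
    -- at y_j: (y_j,R_j) ↦ (y_j,B_j)
    (hy4 : ∀ k : Fin (m + 1), σ (Sum.inl k.succ, false) = (Sum.inr (Sum.inl k), true)) :
    (∀ x y : DualFanDart m, (σ * dartFlip).SameCycle x y) ∧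
      numCycles (σ * dartFlip) = 1 ∧
      (2 - (numCycles σ : ℤ) + (3 * (n : ℤ) - 2) - (numCycles (σ * dartFlip) : ℤ)) / 2
        = ((n : ℤ) - 2) / 2 := by
  have step : ∀ (τ : Equiv.Perm (DualFanDart m)) {x y}, τ x = y → τ.SameCycle x y := by
    intro τ x y h
    exact ⟨1, by simpa using h⟩
  have hV : numCycles σ = 2 * m + 5 := by
    rw [numCycles_eq_card_s4 σ (dualFanVertex m) (dualFanSection m)]
    · simp; ring
    · rintro ⟨j | k | k, _ | _⟩
      · cases j using Fin.cases with
        | zero => rw [hr]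
        | succ k => rw [hy4]; simp [dualFanVertex]
      · cases j using Fin.lastCases with
        | last => rw [hv1]
        | cast k => rw [hy2]; simp [dualFanVertex]
      · rw [hb]; rfl
      · rw [hy1]; simp [dualFanVertex]
      · rw [hy3]; simp [dualFanVertex]
      · rw [hv]
    · rintro (t | k | k)
      · fin_cases t <;> simp [dualFanVertex, dualFanSection]
      · rfl
      · rfl
    · have hbb : ∀ i : ℕ, ∀ h : i < m + 1, σ.SameCycle (Sum.inr (Sum.inl 0), false)
          (Sum.inr (Sum.inl ⟨i, h⟩), false) := by
        intro i
        induction i with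
        | zero => intro h; exact Equiv.Perm.SameCycle.refl _ _
        | succ i ih =>
          intro h
          refine (ih (by omega)).trans (step σ ?_).symm
          rw [hb]
          congr 3
          ext
          rw [Fin.val_sub_one_of_ne_zero]
          · simp
          · simp [Fin.ext_iff]
      rintro ⟨j | k | k, _ | _⟩
      · cases j using Fin.cases with
        | zero => exact Equiv.Perm.SameCycle.refl _ _
        | succ k => exact (step σ (hy4 k)).symm
      · cases j using Fin.lastCases with
        | last => simpa [dualFanVertex, dualFanSection] using Equiv.Perm.SameCycle.refl _ _
        | cast k => simpa [dualFanVertex, dualFanSection] using step σ (hy1 k)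
      · exact hbb k.1 k.2
      · exact Equiv.Perm.SameCycle.refl _ _
      · exact ((step σ (hy1 k)).trans (step σ (hy2 k)))
      · exact Equiv.Perm.SameCycle.refl _ _
  have fl : ∀ e b, (σ * dartFlip : Equiv.Perm (DualFanDart m)) (e, b) = σ (e, !b) := fun e b => rfl
  set φ := σ * dartFlip with hφ
  -- R_k false to R_{k+1} false
  have c1 : ∀ k : Fin (m + 1), φ.SameCycle (Sum.inl k.castSucc, false)
      (Sum.inr (Sum.inr k), false) := fun k => step φ (by rw [fl]; exact hy2 k)
  have c2 : ∀ k : Fin (m + 1), φ.SameCycle (Sum.inr (Sum.inr k), false)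
      (Sum.inr (Sum.inr k), true) := fun k => step φ (by rw [fl]; exact hv k)
  have c3 : ∀ k : Fin (m + 1), φ.SameCycle (Sum.inr (Sum.inr k), true)
      (Sum.inl k.succ, false) := fun k => step φ (by rw [fl]; exact hy3 k)
  have c4 : ∀ k : Fin (m + 1), φ.SameCycle (Sum.inl k.succ, true)
      (Sum.inr (Sum.inl k), true) := fun k => step φ (by rw [fl]; exact hy4 k)
  have c5 : φ.SameCycle (Sum.inl 0, true) (Sum.inl 0, false) :=
    step φ (by rw [fl]; exact hr)
  have c6 : ∀ k : Fin (m + 1), φ.SameCycle (Sum.inr (Sum.inl k), true)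
      (Sum.inr (Sum.inl (k - 1)), false) := fun k => step φ (by rw [fl]; exact hb k)
  have c7 : ∀ k : Fin (m + 1), φ.SameCycle (Sum.inr (Sum.inl k), false)
      (Sum.inl k.castSucc, true) := fun k => step φ (by rw [fl]; exact hy1 k)
  have c8 : ∀ k : Fin (m + 1), φ.SameCycle (Sum.inl k.succ, true)
      (Sum.inl (k - 1).castSucc, true) := fun k => ((c4 k).trans (c6 k)).trans (c7 _)
  have d1 : ∀ j : Fin (m + 2), φ.SameCycle (Sum.inl 0, false) (Sum.inl j, false) := by
    intro j
    induction j using Fin.induction with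
    | zero => exact Equiv.Perm.SameCycle.refl _ _
    | succ k ih => exact ((ih.trans (c1 k)).trans (c2 k)).trans (c3 k)
  have e2 : ∀ i : ℕ, ∀ h : i + 2 < m + 2, φ.SameCycle (Sum.inl ⟨i + 2, h⟩, true)
      (Sum.inl ⟨i, by omega⟩, true) := by
    intro i h
    have := c8 ⟨i + 1, by omega⟩
    convert this using 3
    · rfl
    · ext
      rw [Fin.val_castSucc, Fin.val_sub_one_of_ne_zero]
      · simp
      · simp [Fin.ext_iff]
  have e0 : ∀ i : ℕ, ∀ h : 2 * i < m + 2, φ.SameCycle (Sum.inl 0, false)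
      (Sum.inl ⟨2 * i, h⟩, true) := by
    intro i
    induction i with
    | zero => intro h; exact c5.symm
    | succ i ih => intro h; exact (ih (by omega)).trans (e2 (2 * i) h).symm
  have hm : ∃ p, m = 2 * p := by
    obtain ⟨q, hq⟩ := hev
    exact ⟨q - 1, by omega⟩
  obtain ⟨p, hp⟩ := hm
  have f1 : φ.SameCycle (Sum.inl 0, false) (Sum.inl ⟨1, by omega⟩, true) := by
    refine (e0 p (by omega)).trans ?_
    have := c8 0
    convert this.symm using 3
    · ext
      simp [hp]
    · rfl
  have e1 : ∀ i : ℕ, ∀ h : 2 * i + 1 < m + 2, φ.SameCycle (Sum.inl 0, false)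
      (Sum.inl ⟨2 * i + 1, h⟩, true) := by
    intro i
    induction i with
    | zero => intro h; exact f1
    | succ i ih => intro h; exact (ih (by omega)).trans (e2 (2 * i + 1) h).symm
  have d2 : ∀ j : Fin (m + 2), φ.SameCycle (Sum.inl 0, false) (Sum.inl j, true) := by
    rintro ⟨j, hj⟩
    rcases Nat.even_or_odd' j with ⟨i, rfl | rfl⟩
    · exact e0 i hj
    · exact e1 i hj
  have all : ∀ x, φ.SameCycle (Sum.inl 0, false) x := by
    rintro ⟨j | k | k, _ | _⟩
    · exact d1 j
    · exact d2 j
    · exact (d2 _).trans (c7 k).symm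
    · exact (d2 _).trans (c4 k)
    · exact (d1 _).trans (c1 k)
    · exact (d1 _).trans (c3 k).symm
  have one : ∀ x y, φ.SameCycle x y := fun x y => (all x).symm.trans (all y)
  have hF := numCycles_eq_one φ (Sum.inl 0, false) one
  refine ⟨one, hF, ?_⟩
  rw [hF, hV, hn]
  push_cast
  congr 1
  ring
end

section
/- For every integer n ≥ 3, the composite permutation σ∘α of the map J_n is a single cycle on all 2(5n−8) darts; that is, J_n has exactly one face. Consequently, since J_n has 3n−3 vertices and 5n−8 edges, its Euler genus (2 − V + E − F)/2 equals n−2. -/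
/-- The edges of the map `J_n`, where `n = m + 3`; there are `5n - 8` of them,
listed by the five constructors `JA, JB, JB', Js, Jt` below. -/
abbrev JEdge (m : ℕ) :=
  Fin (m + 2) ⊕ Fin (m + 1) ⊕ Fin (m + 1) ⊕ Fin (m + 2) ⊕ Fin (m + 1)

/-- The edge `A_{j+1}` of `J_n` (for `j : Fin (m+2)`, so `A_1, …, A_{n-1}`),
where `A_{n-1} = b z_{n-1}`, `A_j = z_{j+1} z_j` for `2 ≤ j ≤ n-2`, and
`A_1 = z_2 v_1`. Its `false` dart is at the endpoint closer to `b` (namely `b`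
for `A_{n-1}` and `z_{j+2}` otherwise), and its `true` dart is at the other
endpoint (`z_{j+1}`, or `v_1` for `A_1`). -/
def JA {m : ℕ} (j : Fin (m + 2)) : JEdge m := Sum.inl j

/-- The edge `B_{k+2} = b x_{k+2}` of `J_n` (for `k : Fin (m+1)`, so
`B_2, …, B_{n-1}`); its `false` dart is at `b` and its `true` dart at `x_{k+2}`. -/
def JB {m : ℕ} (k : Fin (m + 1)) : JEdge m := Sum.inr (Sum.inl k)

/-- The edge `B′_{k+2} = x_{k+2} v_{k+2}` of `J_n` (for `k : Fin (m+1)`); its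
`false` dart is at `x_{k+2}` and its `true` dart at `v_{k+2}`. -/
def JB' {m : ℕ} (k : Fin (m + 1)) : JEdge m := Sum.inr (Sum.inr (Sum.inl k))

/-- The edge `s_{k+2}` of `J_n` (for `k : Fin (m+2)`, so `s_2, …, s_n`), where
`s_2 = r z_2` and `s_{i+1} = r x_i` for `2 ≤ i ≤ n-1`; its `false` dart is at
`r` and its `true` dart at the other endpoint (`z_2`, resp. `x_{k+1}`). -/
def Js {m : ℕ} (k : Fin (m + 2)) : JEdge m := Sum.inr (Sum.inr (Sum.inr (Sum.inl k)))

/-- The edge `t_{k+2} = z_{k+2} v_{k+2}` of `J_n` (for `k : Fin (m+1)`, so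
`t_2, …, t_{n-1}`); its `false` dart is at `z_{k+2}` and its `true` dart at
`v_{k+2}`. -/
def Jt {m : ℕ} (k : Fin (m + 1)) : JEdge m := Sum.inr (Sum.inr (Sum.inr (Sum.inr k)))

/-- The darts of `J_n`: each edge carries two darts, `false` and `true`, as
described in the docstrings of `JA, JB, JB', Js, Jt`. -/
abbrev JDart (m : ℕ) := JEdge m × Bool

theorem same_of_eq {D : Type*} {f : Equiv.Perm D} {x y : D} (h : f x = y) : f.SameCycle x y := by
  subst h
  exact (Equiv.Perm.sameCycle_apply_right).2 (Equiv.Perm.SameCycle.refl f x)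

/-- Vertices: `b` and `r` (as `Bool`), the `v_j`, the `z_j`, the `x_j`. -/
abbrev JVert (m : ℕ) := Bool ⊕ Fin (m + 2) ⊕ Fin (m + 1) ⊕ Fin (m + 1)

def vB {m : ℕ} : JVert m := Sum.inl false
def vR {m : ℕ} : JVert m := Sum.inl true
def vV {m : ℕ} (k : Fin (m + 2)) : JVert m := Sum.inr (Sum.inl k)
def vZ {m : ℕ} (k : Fin (m + 1)) : JVert m := Sum.inr (Sum.inr (Sum.inl k))
def vX {m : ℕ} (k : Fin (m + 1)) : JVert m := Sum.inr (Sum.inr (Sum.inr k))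

/-- The vertex carrying a dart. -/
def vert {m : ℕ} : JDart m → JVert m
  | (Sum.inl j, true) => Fin.cases (vV 0) vZ j
  | (Sum.inl j, false) => Fin.lastCases vB vZ j
  | (Sum.inr (Sum.inl _), false) => vB
  | (Sum.inr (Sum.inl k), true) => vX k
  | (Sum.inr (Sum.inr (Sum.inl k)), false) => vX k
  | (Sum.inr (Sum.inr (Sum.inl k)), true) => vV k.succ
  | (Sum.inr (Sum.inr (Sum.inr (Sum.inl _))), false) => vR
  | (Sum.inr (Sum.inr (Sum.inr (Sum.inl k))), true) => Fin.cases (vZ 0) vX k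
  | (Sum.inr (Sum.inr (Sum.inr (Sum.inr k))), false) => vZ k
  | (Sum.inr (Sum.inr (Sum.inr (Sum.inr k))), true) => vV k.succ

/-- A chosen dart at each vertex. -/
def vrep {m : ℕ} : JVert m → JDart m
  | Sum.inl false => (JA (Fin.last (m + 1)), false)
  | Sum.inl true => (Js 0, false)
  | Sum.inr (Sum.inl j) => Fin.cases (JA 0, true) (fun k => (Jt k, true)) j
  | Sum.inr (Sum.inr (Sum.inl k)) => (Jt k, false)
  | Sum.inr (Sum.inr (Sum.inr k)) => (JB k, true)

section
variable {m : ℕ}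
theorem vert_A0 : vert (m := m) (JA 0, true) = vV 0 := rfl
theorem vert_A1 : vert (m := m) (JA 1, true) = vZ 0 := rfl
theorem vert_AS (k : Fin (m + 1)) : vert (JA k.succ, true) = vZ k := rfl
theorem vert_AL : vert (m := m) (JA (Fin.last (m + 1)), false) = vB := by
  simp [vert, JA]
theorem vert_AC (k : Fin (m + 1)) : vert (JA k.castSucc, false) = vZ k := by
  simp [vert, JA]
theorem vert_A0f : vert (m := m) (JA 0, false) = vZ 0 := vert_AC 0
theorem vert_Bf (k : Fin (m + 1)) : vert (JB k, false) = vB := rfl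
theorem vert_Bt (k : Fin (m + 1)) : vert (JB k, true) = vX k := rfl
theorem vert_Bpf (k : Fin (m + 1)) : vert (JB' k, false) = vX k := rfl
theorem vert_Bpt (k : Fin (m + 1)) : vert (JB' k, true) = vV k.succ := rfl
theorem vert_sf (k : Fin (m + 2)) : vert (Js k, false) = vR := rfl
theorem vert_s0 : vert (m := m) (Js 0, true) = vZ 0 := rfl
theorem vert_sS (k : Fin (m + 1)) : vert (Js k.succ, true) = vX k := rfl
theorem vert_tf (k : Fin (m + 1)) : vert (Jt k, false) = vZ k := rfl
theorem vert_tt (k : Fin (m + 1)) : vert (Jt k, true) = vV k.succ := rfl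

theorem vert_vrep (w : JVert m) : vert (vrep w) = w := by
  rcases w with (_ | _) | j | k | k
  · exact vert_AL
  · rfl
  · refine Fin.cases rfl (fun k => rfl) j
  · rfl
  · rfl

/-- Case analysis on darts. -/
theorem dart_ind {P : JDart m → Prop}
    (a0 : P (JA 0, true)) (a1 : P (JA 1, true)) (aS : ∀ k : Fin m, P (JA k.succ.succ, true))
    (aL : P (JA (Fin.last (m + 1)), false)) (a0f : P (JA 0, false))
    (aC : ∀ k : Fin m, P (JA k.succ.castSucc, false))
    (b0 : P (JB 0, false)) (bS : ∀ k : Fin m, P (JB k.succ, false))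
    (bt : ∀ k : Fin (m + 1), P (JB k, true))
    (bpf : ∀ k : Fin (m + 1), P (JB' k, false)) (bpt : ∀ k : Fin (m + 1), P (JB' k, true))
    (sf : ∀ k : Fin (m + 2), P (Js k, false))
    (s0 : P (Js 0, true)) (sS : ∀ k : Fin (m + 1), P (Js k.succ, true))
    (t0 : P (Jt 0, false)) (tS : ∀ k : Fin m, P (Jt k.succ, false))
    (tt : ∀ k : Fin (m + 1), P (Jt k, true)) (d : JDart m) : P d := by
  rcases d with ⟨j | k | k | k | k, _ | _⟩
  · induction j using Fin.lastCases with
    | last => exact aL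
    | cast j =>
      induction j using Fin.cases with
      | zero => exact a0f
      | succ k => exact aC k
  · induction j using Fin.cases with
    | zero => exact a0
    | succ j =>
      induction j using Fin.cases with
      | zero => exact a1
      | succ k => exact aS k
  · induction k using Fin.cases with
    | zero => exact b0
    | succ k => exact bS k
  · exact bt k
  · exact bpf k
  · exact bpt k
  · exact sf k
  · induction k using Fin.cases with
    | zero => exact s0
    | succ k => exact sS k
  · induction k using Fin.cases with
    | zero => exact t0
    | succ k => exact tS k
  · exact tt k
end

theorem numCycles_eq {D W : Type*} [Finite D] (σ : Equiv.Perm D) (v : D → W) (r : W → D)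
    (hvr : ∀ w, v (r w) = w) (hσ : ∀ d, v (σ d) = v d) (hr : ∀ d, σ.SameCycle (r (v d)) d) :
    numCycles σ = Nat.card W := by
  have hpow : ∀ (k : ℕ) d, v ((σ ^ k) d) = v d := by
    intro k
    induction k with
    | zero => intro d; rfl
    | succ k ih => intro d; rw [pow_succ, Equiv.Perm.mul_apply, ih, hσ]
  have hinv : ∀ x y, σ.SameCycle x y → v x = v y := by
    intro x y h
    obtain ⟨k, -, rfl⟩ := h.exists_pow_eq'
    exact (hpow k x).symm
  unfold numCycles
  refine Nat.card_congr ⟨Quotient.lift v hinv, fun w => Quotient.mk _ (r w), ?_, ?_⟩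
  · intro q
    induction q using Quotient.inductionOn with
    | h d => exact Quotient.sound (hr d)
  · intro w
    exact hvr w

/-- For every `n ≥ 3` (written `n = m + 3`), the composite
permutation `σ ∘ α` of the map `J_n` is a single cycle on all `2(5n-8)` darts,
i.e. `J_n` has exactly one face; consequently (as `J_n` has `3n-3` vertices and
`5n-8` edges) its Euler genus `(2 - V + E - F)/2` equals `n - 2`.

Here `σ` is the rotation of `J_n`, specified by the hypotheses: it fixes the
unique dart at `v_1`; at each `v_j` (`2 ≤ j ≤ n-1`) it exchanges `(v_j,B′_j)`
and `(v_j,t_j)`; at `b` it is the cycle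
`(b,B_{n-1}) → (b,B_{n-2}) → ⋯ → (b,B_2) → (b,A_{n-1}) → (b,B_{n-1})`;
at `r` it is the cycle `(r,s_2) → (r,s_3) → ⋯ → (r,s_n) → (r,s_2)`; at `z_2`
it is the 4-cycle `(z_2,A_2) → (z_2,s_2) → (z_2,A_1) → (z_2,t_2) → (z_2,A_2)`;
at each `z_j` (`3 ≤ j ≤ n-1`) it is the 3-cycle
`(z_j,A_j) → (z_j,A_{j-1}) → (z_j,t_j) → (z_j,A_j)`; and at each `x_i`
(`2 ≤ i ≤ n-1`) it is the 3-cycle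
`(x_i,B_i) → (x_i,s_{i+1}) → (x_i,B′_i) → (x_i,B_i)`. -/
theorem J_map_one_face (m n : ℕ) (hn : n = m + 3)
    (σ : Equiv.Perm (JDart m))
    -- σ fixes the unique dart at v_1 (the dart of A_1 at v_1)
    (hv1 : σ (JA 0, true) = (JA 0, true))
    -- at v_{k+2}: exchange (v,B′) and (v,t)
    (hva : ∀ k : Fin (m + 1), σ (JB' k, true) = (Jt k, true))
    (hvb : ∀ k : Fin (m + 1), σ (Jt k, true) = (JB' k, true))
    -- at b: (b,B_j) ↦ (b,B_{j-1}) for 3 ≤ j ≤ n-1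
    (hb1 : ∀ k : Fin m, σ (JB k.succ, false) = (JB k.castSucc, false))
    -- at b: (b,B_2) ↦ (b,A_{n-1})
    (hb2 : σ (JB 0, false) = (JA (Fin.last (m + 1)), false))
    -- at b: (b,A_{n-1}) ↦ (b,B_{n-1})
    (hb3 : σ (JA (Fin.last (m + 1)), false) = (JB (Fin.last m), false))
    -- at r: (r,s_j) ↦ (r,s_{j+1}), cyclically (so (r,s_n) ↦ (r,s_2))
    (hr : ∀ k : Fin (m + 2), σ (Js k, false) = (Js (k + 1), false))
    -- at z_2: the 4-cycle (z_2,A_2) → (z_2,s_2) → (z_2,A_1) → (z_2,t_2) → (z_2,A_2)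
    (hz2a : σ (JA 1, true) = (Js 0, true))
    (hz2b : σ (Js 0, true) = (JA 0, false))
    (hz2c : σ (JA 0, false) = (Jt 0, false))
    (hz2d : σ (Jt 0, false) = (JA 1, true))
    -- at z_j (j = k+3): (z_j,A_j) ↦ (z_j,A_{j-1})
    (hza : ∀ k : Fin m, σ (JA k.succ.succ, true) = (JA k.succ.castSucc, false))
    -- at z_j: (z_j,A_{j-1}) ↦ (z_j,t_j)
    (hzb : ∀ k : Fin m, σ (JA k.succ.castSucc, false) = (Jt k.succ, false))
    -- at z_j: (z_j,t_j) ↦ (z_j,A_j)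
    (hzc : ∀ k : Fin m, σ (Jt k.succ, false) = (JA k.succ.succ, true))
    -- at x_i (i = k+2): (x_i,B_i) ↦ (x_i,s_{i+1})
    (hxa : ∀ k : Fin (m + 1), σ (JB k, true) = (Js k.succ, true))
    -- at x_i: (x_i,s_{i+1}) ↦ (x_i,B′_i)
    (hxb : ∀ k : Fin (m + 1), σ (Js k.succ, true) = (JB' k, false))
    -- at x_i: (x_i,B′_i) ↦ (x_i,B_i)
    (hxc : ∀ k : Fin (m + 1), σ (JB' k, false) = (JB k, true)) :
    (∀ x y : JDart m, (σ * dartFlip).SameCycle x y) ∧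
      numCycles (σ * dartFlip) = 1 ∧
      (2 - (numCycles σ : ℤ) + (5 * (n : ℤ) - 8) - (numCycles (σ * dartFlip) : ℤ)) / 2
        = (n : ℤ) - 2 := by
  have hV : numCycles σ = 3 * m + 6 := by
    have hbk : ∀ k : Fin (m + 1), σ.SameCycle (JA (Fin.last (m + 1)), false) (JB k, false) := by
      intro k
      induction k using Fin.induction with
      | zero => exact (same_of_eq hb2).symm
      | succ k ih => exact ih.trans (same_of_eq (hb1 k)).symm
    have hrk : ∀ k : Fin (m + 2), σ.SameCycle (Js 0, false) (Js k, false) := by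
      intro k
      induction k using Fin.induction with
      | zero => exact Equiv.Perm.SameCycle.refl _ _
      | succ k ih =>
        refine ih.trans (same_of_eq ?_)
        rw [hr, Fin.coeSucc_eq_succ]
    rw [numCycles_eq σ vert vrep vert_vrep]
    · simp [JVert]; ring
    · intro d
      induction d using dart_ind with
      | a0 => rw [hv1]
      | a1 => rw [hz2a]; rfl
      | aS k => rw [hza, vert_AC]; rfl
      | aL => rw [hb3, vert_AL]; rfl
      | a0f => rw [hz2c, vert_A0f]; rfl
      | aC k => rw [hzb, vert_AC]; rfl
      | b0 => rw [hb2, vert_AL]; rfl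
      | bS k => rw [hb1]; rfl
      | bt k => rw [hxa]; rfl
      | bpf k => rw [hxc]; rfl
      | bpt k => rw [hva]; rfl
      | sf k => rw [hr]; rfl
      | s0 => rw [hz2b, vert_A0f]; rfl
      | sS k => rw [hxb]; rfl
      | t0 => rw [hz2d]; rfl
      | tS k => rw [hzc]; rfl
      | tt k => rw [hvb]; rfl
    · intro d
      induction d using dart_ind with
      | a0 => exact Equiv.Perm.SameCycle.refl _ _
      | a1 => exact same_of_eq hz2d
      | aS k => exact same_of_eq (hzc k)
      | aL => rw [vert_AL]; exact Equiv.Perm.SameCycle.refl _ _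
      | a0f => rw [vert_A0f]; exact (same_of_eq hz2c).symm
      | aC k => rw [vert_AC]; exact (same_of_eq (hzb k)).symm
      | b0 => exact hbk _
      | bS k => exact hbk _
      | bt k => exact Equiv.Perm.SameCycle.refl _ _
      | bpf k => exact (same_of_eq (hxc k)).symm
      | bpt k => exact (same_of_eq (hva k)).symm
      | sf k => exact hrk k
      | s0 => exact (same_of_eq hz2d).trans (same_of_eq hz2a)
      | sS k => exact same_of_eq (hxa k)
      | t0 => exact Equiv.Perm.SameCycle.refl _ _
      | tS k => exact Equiv.Perm.SameCycle.refl _ _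
      | tt k => exact Equiv.Perm.SameCycle.refl _ _
  have hF : ∀ x y : JDart m, (σ * dartFlip).SameCycle x y := by
    have ft : ∀ {e : JEdge m} {d : JDart m}, σ (e, true) = d →
        (σ * dartFlip).SameCycle (e, false) d := fun h => same_of_eq h
    have tf : ∀ {e : JEdge m} {d : JDart m}, σ (e, false) = d →
        (σ * dartFlip).SameCycle (e, true) d := fun h => same_of_eq h
    have htA : ∀ k : Fin (m + 1),
        (σ * dartFlip).SameCycle (Jt k, true) (JA k.succ, true) := by
      intro k
      induction k using Fin.cases with
      | zero => exact tf hz2d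
      | succ k => exact tf (hzc k)
    have hss : ∀ k : Fin (m + 1),
        (σ * dartFlip).SameCycle (Js k.castSucc, true) (Js k.succ, false) := by
      intro k
      refine tf ?_
      rw [hr, Fin.coeSucc_eq_succ]
    -- from s_k to A_{k+1}
    have h1 : ∀ k : Fin (m + 1),
        (σ * dartFlip).SameCycle (Js k.castSucc, true) (JA k.succ, true) := fun k =>
      (hss k).trans ((ft (hxb k)).trans ((ft (hva k)).trans (htA k)))
    have h2 : ∀ k : Fin m,
        (σ * dartFlip).SameCycle (JA k.castSucc.succ, true) (JB k.succ, true) := fun k =>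
      (tf (hzb k)).trans ((ft (hvb k.succ)).trans (tf (hxc k.succ)))
    have h3 : ∀ k : Fin (m + 1),
        (σ * dartFlip).SameCycle (JA k.succ, true) (JB k, false) := by
      intro k
      induction k using Fin.lastCases with
      | last => exact tf hb3
      | cast k => exact (h2 k).trans (tf (hb1 k))
    have hs : ∀ k : Fin (m + 2), (σ * dartFlip).SameCycle (Js 0, true) (Js k, true) := by
      intro k
      induction k using Fin.induction with
      | zero => exact Equiv.Perm.SameCycle.refl _ _
      | succ k ih => exact ih.trans ((h1 k).trans ((h3 k).trans (ft (hxa k))))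
    have hA : ∀ k : Fin (m + 1), (σ * dartFlip).SameCycle (Js 0, true) (JA k.succ, true) :=
      fun k => (hs _).trans (h1 k)
    have hB : ∀ k : Fin (m + 1), (σ * dartFlip).SameCycle (Js 0, true) (JB k, false) :=
      fun k => (hA k).trans (h3 k)
    have hsf : ∀ k : Fin (m + 2), (σ * dartFlip).SameCycle (Js 0, true) (Js k, false) := by
      intro k
      induction k using Fin.cases with
      | zero =>
        refine (hs (Fin.last (m + 1))).trans (tf ?_)
        rw [hr, Fin.last_add_one]
      | succ k => exact (hs _).trans (hss k)
    have hA0f : (σ * dartFlip).SameCycle (Js 0, true) (JA 0, false) := (hsf 0).trans (ft hz2b)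
    have hA0 := hA0f.trans (ft hv1)
    have ht0 := hA0.trans (tf hz2c)
    have ht : ∀ k : Fin (m + 1), (σ * dartFlip).SameCycle (Js 0, true) (Jt k, false) := by
      intro k
      induction k using Fin.cases with
      | zero => exact ht0
      | succ k => exact (hA k.castSucc).trans (tf (hzb k))
    have hBpt : ∀ k : Fin (m + 1), (σ * dartFlip).SameCycle (Js 0, true) (JB' k, true) :=
      fun k => (ht k).trans (ft (hvb k))
    have hBpf : ∀ k : Fin (m + 1), (σ * dartFlip).SameCycle (Js 0, true) (JB' k, false) :=
      fun k => (hsf k.succ).trans (ft (hxb k))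
    have hAf : ∀ k : Fin (m + 1), (σ * dartFlip).SameCycle (Js 0, true) (JA k.succ, false) := by
      intro k
      induction k using Fin.induction with
      | zero => exact (ft hz2a).symm
      | succ k ih => exact ih.trans (ft (hza k)).symm
    have key : ∀ d : JDart m, (σ * dartFlip).SameCycle (Js 0, true) d := by
      intro d
      induction d using dart_ind with
      | a0 => exact hA0
      | a1 => exact hA 0
      | aS k => exact hA k.succ
      | aL => exact hAf (Fin.last m)
      | a0f => exact hA0f
      | aC k => exact hAf k.castSucc
      | b0 => exact hB 0
      | bS k => exact hB k.succ
      | bt k => exact (hBpt k).trans (tf (hxc k))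
      | bpf k => exact hBpf k
      | bpt k => exact hBpt k
      | sf k => exact hsf k
      | s0 => exact hs 0
      | sS k => exact hs k.succ
      | t0 => exact ht 0
      | tS k => exact ht k.succ
      | tt k => exact (hBpf k).trans (ft (hva k))
    exact fun x y => (key x).symm.trans (key y)
  have hF1 : numCycles (σ * dartFlip) = 1 := by
    rw [numCycles_eq (σ * dartFlip) (fun _ => ()) (fun _ => (JA 0, true))
      (fun _ => rfl) (fun _ => rfl) (fun _ => hF _ _)]
    simp
  refine ⟨hF, hF1, ?_⟩
  rw [hF1, hV, hn]
  push_cast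
  omega
end
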